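/- Let A be an analytic subset of SB such that every Y ∈ A has a Schauder basis. Then there exist a separable Banach space X, a pruned tree T on ℕ×ℕ, and a normalized sequence (x_t) indexed by the non-empty sequences of T, such that: (i) (X, ℕ×ℕ, T, (x_t)) is a Schauder tree basis; (ii) for every Y ∈ A there exists a branch σ ∈ [T] with Y isomorphic to X_σ; (iii) for every branch σ ∈ [T] there exists Y ∈ A with X_σ isomorphic to Y. -/

import Mathlib

open Filter Topology MeasureTheory

noncomputable section

/-! ### The Cantor set and the space `C(2^ℕ)` -/

/-- The Cantor set `2^ℕ`. -/
abbrev CantorSet : Type := ℕ → Bool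

/-- The Banach space `C(2^ℕ)` of continuous real-valued functions on the Cantor set. -/
abbrev CantorC : Type := C(CantorSet, ℝ)

/-! ### The standard Borel space `SB` of separable Banach spaces -/

/-- `SB`: the set of closed linear subspaces of `C(2^ℕ)`. -/
def SB : Type := {Y : Submodule ℝ CantorC // IsClosed (Y : Set CantorC)}

/-- The Effros-Borel σ-algebra on `SB`, generated by the sets
`{Y : Y ∩ U ≠ ∅}` for `U` open in `C(2^ℕ)`. -/
instance : MeasurableSpace SB :=
  MeasurableSpace.generateFrom
    {A : Set SB | ∃ U : Set CantorC, IsOpen U ∧ A = {Y : SB | ((Y.1 : Set CantorC) ∩ U).Nonempty}}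

/-- A subset of a standard Borel space is analytic if it is the image of a Borel map
from the Baire space `ℕ^ℕ`. -/
def IsAnalyticIn {α : Type*} [MeasurableSpace α] (A : Set α) : Prop :=
  ∃ f : (ℕ → ℕ) → α, Measurable f ∧ A = Set.range f

/-! ### Embeddings, isomorphisms, universality -/

/-- `X` embeds isomorphically into `Y`: there is a bounded linear map which is
bounded below, i.e. an isomorphism onto its range. -/
def Embeds (X Y : Type*) [SeminormedAddCommGroup X] [NormedSpace ℝ X]
    [SeminormedAddCommGroup Y] [NormedSpace ℝ Y] : Prop :=
  ∃ (T : X →L[ℝ] Y) (c : ℝ), 0 < c ∧ ∀ x : X, c * ‖x‖ ≤ ‖T x‖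

/-- `X` embeds isometrically into `Y` (i.e. `Y` contains an isometric copy of `X`). -/
def EmbedsIsometrically (X Y : Type*) [SeminormedAddCommGroup X] [NormedSpace ℝ X]
    [SeminormedAddCommGroup Y] [NormedSpace ℝ Y] : Prop :=
  Nonempty (X →ₗᵢ[ℝ] Y)

/-- `X` and `Y` are isomorphic Banach spaces (linearly homeomorphic). -/
def IsomorphicTo (X Y : Type*) [SeminormedAddCommGroup X] [NormedSpace ℝ X]
    [SeminormedAddCommGroup Y] [NormedSpace ℝ Y] : Prop :=
  Nonempty (X ≃L[ℝ] Y)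

/-- The class `NU ⊆ SB` of non-universal spaces: those `X ∈ SB` which do not contain
an isomorphic copy of `C(2^ℕ)` (equivalently, are not universal for all separable
Banach spaces). -/
def NU : Set SB := {Y : SB | ¬ Embeds CantorC Y.1}

/-- The class `NC_X ⊆ SB` of all `Y ∈ SB` containing no isomorphic copy of `X`. -/
def NCin (X : Type*) [SeminormedAddCommGroup X] [NormedSpace ℝ X] : Set SB :=
  {Y : SB | ¬ Embeds X Y.1}

/-! ### Schauder bases -/

/-- `x` is a Schauder basis of `E`: every vector has a unique representation as a
norm convergent series `Σ aₙ • xₙ`. -/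
def IsSchauderBasis {E : Type*} [SeminormedAddCommGroup E] [NormedSpace ℝ E]
    (x : ℕ → E) : Prop :=
  ∀ y : E, ∃! a : ℕ → ℝ,
    Tendsto (fun m => ∑ n ∈ Finset.range m, a n • x n) atTop (𝓝 y)

/-- `E` has a Schauder basis. -/
def HasSchauderBasis (E : Type*) [SeminormedAddCommGroup E] [NormedSpace ℝ E] : Prop :=
  ∃ x : ℕ → E, IsSchauderBasis x

/-- `x` is a monotone basis sequence: initial-segment projections have norm at most 1. -/
def IsMonotoneSeq {E : Type*} [SeminormedAddCommGroup E] [NormedSpace ℝ E]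
    (x : ℕ → E) : Prop :=
  ∀ (a : ℕ → ℝ) (k m : ℕ), k ≤ m →
    ‖∑ n ∈ Finset.range k, a n • x n‖ ≤ ‖∑ n ∈ Finset.range m, a n • x n‖

/-- `x` is a bi-monotone sequence: interval projections have norm at most 1. -/
def IsBimonotoneSeq {E : Type*} [SeminormedAddCommGroup E] [NormedSpace ℝ E]
    (x : ℕ → E) : Prop :=
  ∀ (a : ℕ → ℝ) (j k m : ℕ), j ≤ k → k ≤ m →
    ‖∑ n ∈ Finset.Ico j k, a n • x n‖ ≤ ‖∑ n ∈ Finset.range m, a n • x n‖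

/-- `x` is a Schauder basic sequence: it is a Schauder basis of its closed linear span. -/
def IsSchauderBasicSeq {E : Type*} [NormedAddCommGroup E] [NormedSpace ℝ E]
    (x : ℕ → E) : Prop :=
  ∀ y ∈ (Submodule.span ℝ (Set.range x)).topologicalClosure,
    ∃! a : ℕ → ℝ,
      Tendsto (fun m => ∑ n ∈ Finset.range m, a n • x n) atTop (𝓝 y)

/-! ### Trees, ordinal ranks and Bourgain's index -/

/-- A tree on `Λ`: a set of finite sequences closed under initial segments. -/
def IsTree {Λ : Type*} (T : Set (List Λ)) : Prop :=
  ∀ s t : List Λ, s <+: t → t ∈ T → s ∈ T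

/-- A pruned tree: every node has a proper extension in the tree. -/
def IsPruned {Λ : Type*} (T : Set (List Λ)) : Prop :=
  ∀ t ∈ T, ∃ a : Λ, t ++ [a] ∈ T

/-- `σ` is an infinite branch of `T`. -/
def IsBranch {Λ : Type*} (T : Set (List Λ)) (σ : ℕ → Λ) : Prop :=
  ∀ n : ℕ, (List.ofFn fun i : Fin n => σ i) ∈ T

/-- `T` is ill-founded: it has an infinite branch. -/
def TreeIllFounded {Λ : Type*} (T : Set (List Λ)) : Prop :=
  ∃ σ : ℕ → Λ, IsBranch T σ

/-- The derivative of a tree: its non-maximal nodes, i.e. nodes having a proper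
extension in the tree. -/
def treeDeriv {Λ : Type*} (T : Set (List Λ)) : Set (List Λ) :=
  {l | l ∈ T ∧ ∃ a : Λ, l ++ [a] ∈ T}

/-- The iterated derivatives `T^(ξ)` of a tree, defined by transfinite recursion. -/
def treeDerivIter {Λ : Type*} (T : Set (List Λ)) (ξ : Ordinal.{0}) : Set (List Λ) :=
  Ordinal.limitRecOn ξ T (fun _ S => treeDeriv S)
    (fun o _ ih => ⋂ (o' : Ordinal.{0}) (h : o' < o), ih o' h)

/-- The ordinal rank `o(T)` of a (well-founded) tree: the least `ξ` with `T^(ξ) = ∅`. -/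
def treeRank {Λ : Type*} (T : Set (List Λ)) : Ordinal.{0} :=
  sInf {ξ : Ordinal.{0} | treeDerivIter T ξ = ∅}

/-- The first uncountable ordinal `ω₁`. -/
def omega1 : Ordinal.{0} := (Cardinal.aleph 1).ord

/-- Bourgain's tree `T(Y, (e_n), δ)`: all finite sequences `(y_0, …, y_k)` in `Y`
which are `δ`-equivalent to `(e_0, …, e_k)`. -/
def bourgainTree {W : Type*} [SeminormedAddCommGroup W] [NormedSpace ℝ W] (e : ℕ → W)
    (δ : ℝ) (Y : Type*) [SeminormedAddCommGroup Y] [NormedSpace ℝ Y] : Set (List Y) :=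
  {l : List Y | ∀ a : ℕ → ℝ,
    δ * ‖∑ i ∈ Finset.range l.length, a i • e i‖ ≤
        ‖∑ i ∈ Finset.range l.length, a i • l.getD i 0‖ ∧
    ‖∑ i ∈ Finset.range l.length, a i • l.getD i 0‖ ≤
        δ⁻¹ * ‖∑ i ∈ Finset.range l.length, a i • e i‖}

open Classical in
/-- Bourgain's ordinal index of `Y` relative to a (normalized Schauder) basis `(e_n)`
of a space `W`: it equals `ω₁` if some tree `T(Y, (e_n), δ)` is ill-founded, and
otherwise `sup_{0 < δ ≤ 1} o(T(Y, (e_n), δ))`.  With `W = C(2^ℕ)` this is `φ_NU`,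
and with `W = Z` it is `φ_{NC_Z}`. -/
def bourgainIndex {W : Type*} [SeminormedAddCommGroup W] [NormedSpace ℝ W] (e : ℕ → W)
    (Y : Type*) [SeminormedAddCommGroup Y] [NormedSpace ℝ Y] : Ordinal.{0} :=
  if ∃ δ ∈ Set.Ioc (0:ℝ) 1, TreeIllFounded (bourgainTree e δ Y) then omega1
  else ⨆ δ : Set.Ioc (0:ℝ) 1, treeRank (bourgainTree e δ.1 Y)

/-! ### The Schur property and the Radon-Nikodym property -/

/-- `X` has the Schur property: weakly convergent sequences are norm convergent. -/
def HasSchurProperty (X : Type*) [SeminormedAddCommGroup X] [NormedSpace ℝ X] : Prop :=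
  ∀ (f : ℕ → X) (x : X),
    (∀ φ : X →L[ℝ] ℝ, Tendsto (fun n => φ (f n)) atTop (𝓝 (φ x))) →
    Tendsto f atTop (𝓝 x)

/-- `X` has the Radon-Nikodym property: on every finite measure space, every
`X`-valued vector measure of bounded variation which is absolutely continuous
with respect to the measure has a Bochner-integrable density. -/
def HasRNP (X : Type*) [NormedAddCommGroup X] [NormedSpace ℝ X] : Prop :=
  ∀ (Ω : Type) [MeasurableSpace Ω] (μ : Measure Ω), IsFiniteMeasure μ →
    ∀ τ : VectorMeasure Ω X,
      (∀ s : Set Ω, MeasurableSet s → μ s = 0 → τ s = 0) →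
      (∃ C : ℝ, ∀ P : Finset (Set Ω), (∀ s ∈ P, MeasurableSet s) →
        ((P : Set (Set Ω)).Pairwise fun s t => Disjoint s t) →
        ∑ s ∈ P, ‖τ s‖ ≤ C) →
      ∃ g : Ω → X, Integrable g μ ∧
        ∀ s : Set Ω, MeasurableSet s → τ s = ∫ x in s, g x ∂μ

/-! ### `𝓛_{∞,λ}`-spaces -/

/-- The Banach-Mazur distance from `G` to `ℓ∞^n` is at most `θ`, witnessed by an
isomorphism `e` with `‖e‖ ⬝ ‖e⁻¹‖ ≤ θ'` for every `θ' > θ`. -/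
def BMdistToLinftyLE (G : Type*) [SeminormedAddCommGroup G] [NormedSpace ℝ G]
    (n : ℕ) (θ : ℝ) : Prop :=
  ∀ θ' : ℝ, θ < θ' → ∃ e : G ≃L[ℝ] (Fin n → ℝ),
    ‖(e : G →L[ℝ] (Fin n → ℝ))‖ * ‖(e.symm : (Fin n → ℝ) →L[ℝ] G)‖ ≤ θ'

/-- `X` is an (infinite-dimensional) `𝓛_{∞,λ}`-space: every finite-dimensional subspace
`F` of `X` is contained in a finite-dimensional subspace `G` with `d(G, ℓ∞^(dim G)) ≤ λ`. -/
def IsLinftyLam (lam : ℝ) (X : Type*) [NormedAddCommGroup X] [NormedSpace ℝ X] : Prop :=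
  (¬ FiniteDimensional ℝ X) ∧
  ∀ F : Submodule ℝ X, FiniteDimensional ℝ F →
    ∃ G : Submodule ℝ X, F ≤ G ∧ FiniteDimensional ℝ G ∧
      BMdistToLinftyLE G (Module.finrank ℝ G) lam

/-- `X` is an `𝓛_{∞,λ+}`-space: it is an `𝓛_{∞,θ}`-space for every `θ > λ`. -/
def IsLinftyPlus (lam : ℝ) (X : Type*) [NormedAddCommGroup X] [NormedSpace ℝ X] : Prop :=
  ∀ θ : ℝ, lam < θ → IsLinftyLam θ X

/-! ### Minimal spaces and `ℓ₁` -/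

/-- The space `ℓ₁`. -/
abbrev EllOne : Type := lp (fun _ : ℕ => ℝ) 1

/-- `X` is a minimal Banach space: it is infinite-dimensional and embeds isomorphically
into every infinite-dimensional (closed) subspace of itself. -/
def IsMinimal (X : Type*) [NormedAddCommGroup X] [NormedSpace ℝ X] : Prop :=
  (¬ FiniteDimensional ℝ X) ∧
  ∀ Z : Submodule ℝ X, IsClosed (Z : Set X) → ¬ FiniteDimensional ℝ Z → Embeds X Z

end


noncomputable section

/-- The initial segment `σ|n` of an infinite sequence `σ`. -/
def seg {Λ : Type*} (σ : ℕ → Λ) (n : ℕ) : List Λ := List.ofFn fun i : Fin n => σ i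

/-- For a family `(x_t)` indexed by finite sequences and a branch `σ`, the space
`X_σ`: the closed linear span of `{x_{σ|n} : n ≥ 1}`. -/
def branchSubspace {E : Type*} [NormedAddCommGroup E] [NormedSpace ℝ E] {Λ : Type*}
    (x : List Λ → E) (σ : ℕ → Λ) : Submodule ℝ E :=
  (Submodule.span ℝ (Set.range fun n : ℕ => x (seg σ (n + 1)))).topologicalClosure

end

section helpers

variable {E : Type*} [NormedAddCommGroup E] [NormedSpace ℝ E]
variable {F : Type*} [NormedAddCommGroup F] [NormedSpace ℝ F]

/-- The space of convergent sequences of partial sums with respect to `x`. -/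
def ZS (x : ℕ → E) : Submodule ℝ C(OnePoint ℕ, E) where
  carrier := {s | s ((0 : ℕ) : OnePoint ℕ) = 0 ∧
    ∀ n : ℕ, s ((n + 1 : ℕ) : OnePoint ℕ) - s (n : OnePoint ℕ) ∈ Submodule.span ℝ {x n}}
  add_mem' := by
    rintro s t ⟨h1, h2⟩ ⟨h3, h4⟩
    refine ⟨by simp [h1, h3], fun n => ?_⟩
    have := Submodule.add_mem _ (h2 n) (h4 n)
    simp only [ContinuousMap.add_apply]
    convert this using 1
    abel
  zero_mem' := by simp
  smul_mem' := by
    rintro c s ⟨h1, h2⟩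
    refine ⟨by simp [h1], fun n => ?_⟩
    have := Submodule.smul_mem _ c (h2 n)
    simpa only [ContinuousMap.smul_apply, smul_sub] using this

theorem ZS_closed (x : ℕ → E) : IsClosed (ZS x : Set C(OnePoint ℕ, E)) := by
  have : (ZS x : Set C(OnePoint ℕ, E)) = {s | s ((0 : ℕ) : OnePoint ℕ) = 0} ∩
      ⋂ n : ℕ, {s | s ((n + 1 : ℕ) : OnePoint ℕ) - s (n : OnePoint ℕ) ∈
        (Submodule.span ℝ {x n} : Set E)} := by
    ext s; simp [ZS]
  rw [this]
  refine IsClosed.inter (isClosed_eq (by fun_prop) (by fun_prop)) (isClosed_iInter fun n => ?_)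
  exact (Submodule.closed_of_finiteDimensional (Submodule.span ℝ {x n})).preimage
    (by fun_prop)

theorem ZS_coef {x : ℕ → E} {s : C(OnePoint ℕ, E)} (hs : s ∈ ZS x) :
    ∃ a : ℕ → ℝ, ∀ n : ℕ, s (n : OnePoint ℕ) = ∑ i ∈ Finset.range n, a i • x i := by
  obtain ⟨h1, h2⟩ := hs
  simp only [Submodule.mem_span_singleton] at h2
  choose a ha using h2
  refine ⟨a, fun n => ?_⟩
  induction n with
  | zero => simpa using h1
  | succ n ih => rw [Finset.sum_range_succ, ← ih, ha]; abel

theorem ZS_mk {x : ℕ → E} {a : ℕ → ℝ} {y : E}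
    (h : Tendsto (fun m => ∑ n ∈ Finset.range m, a n • x n) atTop (𝓝 y)) :
    OnePoint.continuousMapMkNat _ y h ∈ ZS x := by
  refine ⟨?_, fun n => ?_⟩
  · change ∑ n ∈ Finset.range 0, a n • x n = 0
    simp
  · change ∑ i ∈ Finset.range (n + 1), a i • x i - ∑ i ∈ Finset.range n, a i • x i ∈ _
    rw [Finset.sum_range_succ, add_sub_cancel_left]
    exact Submodule.smul_mem _ _ (Submodule.mem_span_singleton_self _)

theorem tendsto_at_infty {E : Type*} [NormedAddCommGroup E] (s : C(OnePoint ℕ, E)) :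
    Tendsto (fun n : ℕ => s (n : OnePoint ℕ)) atTop (𝓝 (s OnePoint.infty)) :=
  (OnePoint.continuous_iff_from_nat s).1 s.continuous

/-- Evaluation at infinity. -/
def evInf (x : ℕ → E) : ZS x →L[ℝ] E :=
  (ContinuousMap.evalCLM ℝ (OnePoint.infty : OnePoint ℕ)).comp (ZS x).subtypeL

theorem evInf_apply (x : ℕ → E) (s : ZS x) : evInf x s = s.1 OnePoint.infty := rfl

theorem finite_tendsto (x : ℕ → E) (a : ℕ → ℝ) (N : ℕ) :
    Tendsto (fun m => ∑ n ∈ Finset.range m, (if n < N then a n else 0) • x n) atTop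
      (𝓝 (∑ n ∈ Finset.range N, a n • x n)) := by
  refine tendsto_const_nhds.congr' ?_
  filter_upwards [eventually_ge_atTop N] with m hm
  rw [← Finset.sum_subset (Finset.range_mono hm)]
  · refine Finset.sum_congr rfl fun i hi => ?_
    rw [if_pos (Finset.mem_range.1 hi)]
  · intro i _ hi
    rw [if_neg (by simpa using hi), zero_smul]

/-- Basis constant inequality. -/
def BasisConst (x : ℕ → E) (K : ℝ) : Prop :=
  ∀ (a : ℕ → ℝ) (k m : ℕ), k ≤ m →
    ‖∑ n ∈ Finset.range k, a n • x n‖ ≤ K * ‖∑ n ∈ Finset.range m, a n • x n‖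

/-- Schauder's theorem. -/
theorem schauder_const [CompleteSpace E] {x : ℕ → E} (hx : IsSchauderBasis x) :
    ∃ K : ℝ, 0 < K ∧ BasisConst x K := by
  have : CompleteSpace (ZS x) := (ZS_closed x).completeSpace_coe
  have hinj : Function.Injective (evInf x) := by
    rw [injective_iff_map_eq_zero]
    intro s hs
    rw [evInf_apply] at hs
    obtain ⟨a, ha⟩ := ZS_coef s.2
    have ht := tendsto_at_infty s.1
    rw [hs] at ht
    have h0 : a = fun _ => 0 := (hx 0).unique (by simpa only [ha] using ht) (by simp)
    have hn : ∀ n : ℕ, s.1 (n : OnePoint ℕ) = 0 := fun n => by rw [ha, h0]; simp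
    ext p
    induction p using OnePoint.rec with
    | infty => exact hs
    | coe n => exact hn n
  have hsurj : Function.Surjective (evInf x) := fun y => by
    obtain ⟨a, ha, -⟩ := hx y
    exact ⟨⟨_, ZS_mk ha⟩, rfl⟩
  let e := ContinuousLinearEquiv.ofBijective (evInf x)
    (LinearMap.ker_eq_bot.2 hinj) (LinearMap.range_eq_top.2 hsurj)
  refine ⟨‖(e.symm : E →L[ℝ] ZS x)‖ + 1, by positivity, fun a k m hkm => ?_⟩
  let s : ZS x := ⟨_, ZS_mk (finite_tendsto x a m)⟩
  have h1 : e s = ∑ n ∈ Finset.range m, a n • x n := rfl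
  have h2 : s.1 (k : OnePoint ℕ) = ∑ n ∈ Finset.range k, a n • x n := by
    change ∑ n ∈ Finset.range k, (if n < m then a n else 0) • x n = _
    refine Finset.sum_congr rfl fun i hi => ?_
    rw [if_pos (lt_of_lt_of_le (Finset.mem_range.1 hi) hkm)]
  rw [← h1, ← h2]
  calc ‖s.1 (k : OnePoint ℕ)‖ ≤ ‖s.1‖ := ContinuousMap.norm_coe_le_norm _ _
    _ = ‖(e.symm : E →L[ℝ] ZS x) (e s)‖ := by simp
    _ ≤ ‖(e.symm : E →L[ℝ] ZS x)‖ * ‖e s‖ := ContinuousLinearMap.le_opNorm _ _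
    _ ≤ _ := by gcongr; linarith

theorem basic_of_const [CompleteSpace E] {x : ℕ → E} {K : ℝ} (hK : 0 < K) (hx : BasisConst x K)
    (hne : ∀ n, x n ≠ 0) : IsSchauderBasicSeq x := by
  have : CompleteSpace (ZS x) := (ZS_closed x).completeSpace_coe
  have hbd : ∀ s : ZS x, ‖s‖ ≤ K * ‖evInf x s‖ := by
    intro s
    obtain ⟨a, ha⟩ := ZS_coef s.2
    have hn : ∀ n : ℕ, ‖s.1 (n : OnePoint ℕ)‖ ≤ K * ‖evInf x s‖ := by
      intro n
      refine ge_of_tendsto ((tendsto_at_infty s.1).norm.const_mul K) ?_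
      filter_upwards [eventually_ge_atTop n] with m hm
      rw [ha, ha]; exact hx a n m hm
    change ‖s.1‖ ≤ _
    refine (ContinuousMap.norm_le _ (by positivity)).2 fun p => ?_
    induction p using OnePoint.rec with
    | infty => exact le_of_tendsto (tendsto_at_infty s.1).norm (Eventually.of_forall hn)
    | coe n => exact hn n
  have hal : AntilipschitzWith (K.toNNReal) (evInf x) :=
    ContinuousLinearMap.antilipschitz_of_bound _ (by simpa [hK.le] using hbd)
  have hcl : IsClosed (Set.range (evInf x)) := hal.isClosed_range (evInf x).uniformContinuous
  intro y hy
  have hy' : y ∈ LinearMap.range (evInf x : ZS x →ₗ[ℝ] E) := by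
    refine (Submodule.topologicalClosure_minimal _ ?_ hcl) hy
    rw [Submodule.span_le]
    rintro _ ⟨i, rfl⟩
    have := finite_tendsto x (fun j => if j = i then 1 else 0) (i + 1)
    refine ⟨⟨_, ZS_mk this⟩, ?_⟩
    change ∑ n ∈ Finset.range (i + 1), (if n = i then (1 : ℝ) else 0) • x n = x i
    simp
  obtain ⟨s, rfl⟩ := hy'
  obtain ⟨a, ha⟩ := ZS_coef s.2
  have hta : Tendsto (fun m => ∑ n ∈ Finset.range m, a n • x n) atTop (𝓝 (evInf x s)) := by
    have := tendsto_at_infty s.1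
    simp only [ha] at this
    exact this
  refine ⟨a, hta, fun b hb => ?_⟩
  have hd : Tendsto (fun m => ∑ n ∈ Finset.range m, (b n - a n) • x n) atTop (𝓝 0) := by
    have := hb.sub hta
    simpa [sub_smul] using this
  have hz : ∀ n, ∑ i ∈ Finset.range n, (b i - a i) • x i = 0 := by
    intro n
    rw [← norm_le_zero_iff]
    have h1 : Tendsto (fun m => K * ‖∑ n ∈ Finset.range m, (b n - a n) • x n‖) atTop (𝓝 0) := by
      simpa using hd.norm.const_mul K
    refine ge_of_tendsto h1 ?_
    filter_upwards [eventually_ge_atTop n] with m hm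
    exact hx _ n m hm
  funext n
  have h1 := hz (n + 1)
  rw [Finset.sum_range_succ, hz n, zero_add, smul_eq_zero] at h1
  exact sub_eq_zero.1 (h1.resolve_right (hne n))

theorem mem_span_range_nat {x : ℕ → E} {z : E} :
    z ∈ Submodule.span ℝ (Set.range x) ↔
      ∃ (n : ℕ) (a : ℕ → ℝ), ∑ i ∈ Finset.range n, a i • x i = z := by
  constructor
  · intro h
    obtain ⟨c, rfl⟩ := Finsupp.mem_span_range_iff_exists_finsupp.1 h
    refine ⟨c.support.sup id + 1, c, ?_⟩
    rw [Finsupp.sum]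
    symm
    refine Finset.sum_subset ?_ ?_
    · intro i hi
      exact Finset.mem_range.2 (Nat.lt_succ_of_le (Finset.le_sup (f := id) hi))
    · intro i _ hi
      rw [Finsupp.notMem_support_iff.1 hi, zero_smul]
  · rintro ⟨n, a, rfl⟩
    exact Submodule.sum_mem _ fun i _ => Submodule.smul_mem _ _ (Submodule.subset_span ⟨i, rfl⟩)

/-- Domination of `u` by `v`. -/
def DomBy (u : ℕ → E) (v : ℕ → F) (M : ℝ) : Prop :=
  ∀ (a : ℕ → ℝ) (n : ℕ),
    ‖∑ i ∈ Finset.range n, a i • u i‖ ≤ M * ‖∑ i ∈ Finset.range n, a i • v i‖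

theorem equiv_of_bound {G : Type*} [NormedAddCommGroup G] [NormedSpace ℝ G] [CompleteSpace G]
    [CompleteSpace E]
    (L : G →L[ℝ] E) (M : ℝ) (hM : 0 < M) (hL : ∀ z, ‖z‖ ≤ M * ‖L z‖) (g : ℕ → G)
    (hg : (Submodule.span ℝ (Set.range g)).topologicalClosure = ⊤) :
    Nonempty (G ≃L[ℝ] (Submodule.span ℝ (Set.range fun n => L (g n))).topologicalClosure) := by
  have hal : AntilipschitzWith (M.toNNReal) L :=
    ContinuousLinearMap.antilipschitz_of_bound _ (by simpa [hM.le] using hL)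
  have hcl : IsClosed (Set.range L) := hal.isClosed_range L.uniformContinuous
  have heq : LinearMap.range (L : G →ₗ[ℝ] E) =
      (Submodule.span ℝ (Set.range fun n => L (g n))).topologicalClosure := by
    apply le_antisymm
    · rintro _ ⟨z, rfl⟩
      have hz : z ∈ (Submodule.span ℝ (Set.range g)).topologicalClosure := hg ▸ trivial
      have h1 : (Submodule.span ℝ (Set.range g)).topologicalClosure ≤
          ((Submodule.span ℝ (Set.range fun n => L (g n))).topologicalClosure).comap
            (L : G →ₗ[ℝ] E) := by
        refine Submodule.topologicalClosure_minimal _ ?_ ?_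
        · rw [Submodule.span_le]
          rintro _ ⟨i, rfl⟩
          exact Submodule.le_topologicalClosure _ (Submodule.subset_span ⟨i, rfl⟩)
        · exact (Submodule.isClosed_topologicalClosure _).preimage L.continuous
      exact h1 hz
    · refine Submodule.topologicalClosure_minimal _ ?_ hcl
      rw [Submodule.span_le]
      rintro _ ⟨i, rfl⟩
      exact ⟨g i, rfl⟩
  exact ⟨(L.equivRange hal.injective hcl).trans (ContinuousLinearEquiv.ofEq _ _ heq)⟩

theorem span_subtype_dense (W : Submodule ℝ E) (S : Set W)
    (hW : W = (Submodule.span ℝ (Subtype.val '' S)).topologicalClosure) :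
    (Submodule.span ℝ S).topologicalClosure = ⊤ := by
  rw [eq_top_iff]
  rintro ⟨z, hz⟩ -
  change _ ∈ closure (Submodule.span ℝ S : Set W)
  rw [closure_subtype]
  have : (Subtype.val '' (Submodule.span ℝ S : Set W)) =
      (Submodule.span ℝ (Subtype.val '' S) : Set E) := by
    have h1 := Submodule.map_span W.subtype S
    exact congrArg (fun V : Submodule ℝ E => (V : Set E)) h1
  rw [this]
  rw [hW] at hz
  exact hz

theorem iso_of_equiv [CompleteSpace E] [CompleteSpace F] {u : ℕ → E} {v : ℕ → F} {M : ℝ}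
    (hM : 0 < M) (h1 : DomBy u v M) (h2 : DomBy v u M) :
    Nonempty ((Submodule.span ℝ (Set.range u)).topologicalClosure ≃L[ℝ]
      (Submodule.span ℝ (Set.range v)).topologicalClosure) := by
  let w : ℕ → E × F := fun n => (u n, v n)
  let G := (Submodule.span ℝ (Set.range w)).topologicalClosure
  have hcl : IsClosed (G : Set (E × F)) := Submodule.isClosed_topologicalClosure _
  have : CompleteSpace G := hcl.completeSpace_coe
  have hbd : ∀ z : E × F, z ∈ G → ‖z.1‖ ≤ M * ‖z.2‖ ∧ ‖z.2‖ ≤ M * ‖z.1‖ := by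
    intro z hz
    have hc : IsClosed {z : E × F | ‖z.1‖ ≤ M * ‖z.2‖ ∧ ‖z.2‖ ≤ M * ‖z.1‖} :=
      (isClosed_le (by fun_prop) (by fun_prop)).and (isClosed_le (by fun_prop) (by fun_prop))
    refine (closure_minimal ?_ hc) hz
    intro z hz
    obtain ⟨n, a, rfl⟩ := mem_span_range_nat.1 hz
    simp only [w, Set.mem_ofPred_eq, Prod.fst_sum, Prod.snd_sum, Prod.smul_fst, Prod.smul_snd]
    exact ⟨h1 a n, h2 a n⟩
  let g : ℕ → G := fun n => ⟨w n, Submodule.le_topologicalClosure _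
    (Submodule.subset_span ⟨n, rfl⟩)⟩
  have hg : (Submodule.span ℝ (Set.range g)).topologicalClosure = ⊤ := by
    refine span_subtype_dense G _ ?_
    rw [← Set.range_comp]
    rfl
  have hM1 : ∀ z : E × F, z ∈ G → ‖z‖ ≤ (M + 1) * ‖z.1‖ ∧ ‖z‖ ≤ (M + 1) * ‖z.2‖ := by
    intro z hz
    obtain ⟨h3, h4⟩ := hbd z hz
    have := norm_nonneg z.1
    have := norm_nonneg z.2
    rw [Prod.norm_def]
    refine ⟨max_le ?_ ?_, max_le ?_ ?_⟩ <;> nlinarith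
  obtain ⟨e1⟩ := equiv_of_bound ((ContinuousLinearMap.fst ℝ E F).comp G.subtypeL) (M + 1)
    (by positivity) (fun z => (hM1 z.1 z.2).1) g hg
  obtain ⟨e2⟩ := equiv_of_bound ((ContinuousLinearMap.snd ℝ E F).comp G.subtypeL) (M + 1)
    (by positivity) (fun z => (hM1 z.1 z.2).2) g hg
  exact ⟨e1.symm.trans e2⟩

theorem perturb {y d : ℕ → E} {K : ℝ} (hK : 0 < K) (hy : BasisConst y K) (hn : ∀ n, ‖y n‖ = 1)
    (hd : ∀ n, ‖y n - d n‖ ≤ (1 / 2) ^ n / (8 * K)) :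
    DomBy y d 2 ∧ DomBy d y 2 := by
  have key : ∀ (a : ℕ → ℝ) (n : ℕ),
      ‖∑ i ∈ Finset.range n, a i • y i - ∑ i ∈ Finset.range n, a i • d i‖ ≤
        (1 / 2) * ‖∑ i ∈ Finset.range n, a i • y i‖ := by
    intro a n
    set S := ‖∑ i ∈ Finset.range n, a i • y i‖ with hS
    have hS0 : 0 ≤ S := norm_nonneg _
    have hcoef : ∀ i ∈ Finset.range n, |a i| ≤ 2 * K * S := by
      intro i hi
      have hi' := Finset.mem_range.1 hi
      have e1 := hy a (i + 1) n hi'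
      have e2 := hy a i n hi'.le
      have e3 : a i • y i = ∑ j ∈ Finset.range (i + 1), a j • y j -
          ∑ j ∈ Finset.range i, a j • y j := by
        rw [Finset.sum_range_succ, add_sub_cancel_left]
      have e4 : |a i| = ‖a i • y i‖ := by rw [norm_smul, hn, mul_one, Real.norm_eq_abs]
      rw [e4, e3]
      refine (norm_sub_le _ _).trans ?_
      linarith
    rw [← Finset.sum_sub_distrib]
    calc ‖∑ i ∈ Finset.range n, (a i • y i - a i • d i)‖
        ≤ ∑ i ∈ Finset.range n, ‖a i • y i - a i • d i‖ := norm_sum_le _ _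
      _ ≤ ∑ i ∈ Finset.range n, (2 * K * S) * ((1 / 2) ^ i / (8 * K)) := by
          refine Finset.sum_le_sum fun i hi => ?_
          rw [← smul_sub, norm_smul, Real.norm_eq_abs]
          exact mul_le_mul (hcoef i hi) (hd i) (norm_nonneg _) (by positivity)
      _ = (S / 4) * ∑ i ∈ Finset.range n, (1 / 2 : ℝ) ^ i := by
          rw [Finset.mul_sum]
          refine Finset.sum_congr rfl fun i _ => ?_
          field_simp
          ring
      _ ≤ (S / 4) * 2 := by
          gcongr
          exact sum_geometric_two_le n
      _ = (1 / 2) * S := by ring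
  constructor
  · intro a n
    have h1 := key a n
    have h2 := norm_sub_norm_le (∑ i ∈ Finset.range n, a i • y i) (∑ i ∈ Finset.range n, a i • d i)
    linarith
  · intro a n
    have h1 := key a n
    have h2 := norm_sub_norm_le (∑ i ∈ Finset.range n, a i • d i) (∑ i ∈ Finset.range n, a i • y i)
    rw [norm_sub_rev] at h2
    have := norm_nonneg (∑ i ∈ Finset.range n, a i • y i)
    linarith

theorem DomBy.trans {H : Type*} [NormedAddCommGroup H] [NormedSpace ℝ H]
    {u : ℕ → E} {v : ℕ → F} {w : ℕ → H} {M N : ℝ} (hM : 0 ≤ M)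
    (h1 : DomBy u v M) (h2 : DomBy v w N) : DomBy u w (M * N) := fun a n =>
  (h1 a n).trans (by rw [mul_assoc]; exact mul_le_mul_of_nonneg_left (h2 a n) hM)

theorem DomBy.mono {u : ℕ → E} {v : ℕ → F} {M N : ℝ} (hMN : M ≤ N)
    (h1 : DomBy u v M) : DomBy u v N := fun a n =>
  (h1 a n).trans (mul_le_mul_of_nonneg_right hMN (norm_nonneg _))

theorem const_of_dom {u : ℕ → E} {v : ℕ → F} {M K : ℝ} (hM : 0 ≤ M) (hK : 0 ≤ K)
    (h1 : DomBy u v M) (h2 : DomBy v u M) (hv : BasisConst v K) : BasisConst u (M * K * M) := by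
  intro a k m hkm
  calc _ ≤ M * ‖∑ i ∈ Finset.range k, a i • v i‖ := h1 a k
    _ ≤ M * (K * ‖∑ i ∈ Finset.range m, a i • v i‖) := by gcongr; exact hv a k m hkm
    _ ≤ M * (K * (M * ‖∑ i ∈ Finset.range m, a i • u i‖)) := by gcongr; exact h2 a m
    _ = _ := by ring

end helpers

section construction

/-- Whether `q` takes the value `true` at some index at most `n`. -/
def hit (q : ℕ → Bool) : ℕ → Bool
  | 0 => q 0
  | n + 1 => hit q n || q (n + 1)

theorem hit_iff (q : ℕ → Bool) (n : ℕ) : hit q n = true ↔ ∃ i ≤ n, q i = true := by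
  induction n with
  | zero => simp [hit]
  | succ n ih =>
    simp only [hit, Bool.or_eq_true, ih]
    constructor
    · rintro (⟨i, hi, h⟩ | h)
      · exact ⟨i, by omega, h⟩
      · exact ⟨n + 1, le_rfl, h⟩
    · rintro ⟨i, hi, h⟩
      rcases Nat.lt_or_ge n i with h1 | h1
      · right
        have : i = n + 1 := by omega
        rwa [← this]
      · left; exact ⟨i, h1, h⟩

theorem hit_continuous (n : ℕ) : Continuous fun q : ℕ → Bool => hit q n := by
  induction n with
  | zero => exact continuous_apply 0
  | succ n ih =>
    exact (continuous_of_discreteTopology (f := fun p : Bool × Bool => p.1 || p.2)).comp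
      (ih.prodMk (continuous_apply (n + 1)))

theorem hit_threshold (q : ℕ → Bool) (m : ℕ) :
    ∃ j ≤ m, ∀ n < m, (hit q n = true ↔ j ≤ n) := by
  classical
  by_cases h : ∃ i, q i = true
  · refine ⟨min (Nat.find h) m, min_le_right _ _, fun n hn => ?_⟩
    rw [hit_iff]
    constructor
    · rintro ⟨i, hi, hq⟩
      exact (min_le_left _ _).trans ((Nat.find_min' h hq).trans hi)
    · intro hle
      refine ⟨Nat.find h, ?_, Nat.find_spec h⟩
      omega
  · refine ⟨m, le_rfl, fun n hn => ?_⟩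
    rw [hit_iff]
    push Not at h
    constructor
    · rintro ⟨i, _, hq⟩
      exact absurd hq (by simpa using h i)
    · intro; omega

/-- Indicator that `n` lies in the interval coded by `z`. -/
def ind (z : CantorSet) (n : ℕ) : ℝ :=
  if (hit (fun m => z (3 * m + 1)) n && !hit (fun m => z (3 * m + 2)) n) = true then 1 else 0

theorem ind_continuous (n : ℕ) : Continuous fun z : CantorSet => ind z n := by
  have h1 : Continuous fun z : CantorSet => hit (fun m => z (3 * m + 1)) n :=
    (hit_continuous n).comp (by fun_prop)
  have h2 : Continuous fun z : CantorSet => hit (fun m => z (3 * m + 2)) n :=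
    (hit_continuous n).comp (by fun_prop)
  exact (continuous_of_discreteTopology
    (f := fun p : Bool × Bool => if (p.1 && !p.2) = true then (1 : ℝ) else 0)).comp
      (h1.prodMk h2)

/-- The building blocks of the tree space. -/
def EV (n : ℕ) (f : CantorC) : CantorC where
  toFun z := ind z n * f (fun m => z (3 * m))
  continuous_toFun := (ind_continuous n).mul (f.continuous.comp (by fun_prop))

theorem EV_apply (n : ℕ) (f : CantorC) (z : CantorSet) :
    EV n f z = ind z n * f (fun m => z (3 * m)) := rfl

theorem sum_EV_apply (v : ℕ → CantorC) (a : ℕ → ℝ) (m : ℕ) (z : CantorSet) (j l : ℕ)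
    (hl : l ≤ m)
    (h : ∀ n < m, ind z n = if n ∈ Finset.Ico j l then 1 else 0) :
    (∑ n ∈ Finset.range m, a n • EV n (v n)) z =
      (∑ n ∈ Finset.Ico j l, a n • v n) (fun m => z (3 * m)) := by
  simp only [ContinuousMap.coe_sum, ContinuousMap.coe_smul, Finset.sum_apply, Pi.smul_apply,
    EV_apply, smul_eq_mul]
  have hsub : Finset.Ico j l ⊆ Finset.range m := by
    intro i hi
    simp only [Finset.mem_Ico, Finset.mem_range] at *
    omega
  rw [← Finset.sum_subset hsub]
  · refine Finset.sum_congr rfl fun i hi => ?_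
    rw [h i (Finset.mem_range.1 (hsub hi)), if_pos hi, one_mul]
  · intro i hi hni
    rw [h i (Finset.mem_range.1 hi), if_neg hni, zero_mul, mul_zero]

theorem EV_lower (v : ℕ → CantorC) (a : ℕ → ℝ) (j l m : ℕ) (hl : l ≤ m) :
    ‖∑ n ∈ Finset.Ico j l, a n • v n‖ ≤ ‖∑ n ∈ Finset.range m, a n • EV n (v n)‖ := by
  refine (ContinuousMap.norm_le _ (norm_nonneg _)).2 fun p => ?_
  let z : CantorSet := fun i =>
    if i % 3 = 0 then p (i / 3) else if i % 3 = 1 then decide (i / 3 = j) else decide (i / 3 = l)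
  have hz0 : (fun i => z (3 * i)) = p := by
    funext i
    simp only [z]
    rw [if_pos (by omega)]
    congr 1; omega
  have hz1 : (fun i => z (3 * i + 1)) = fun i => decide (i = j) := by
    funext i
    simp only [z]
    rw [if_neg (by omega), if_pos (by omega)]
    congr 2; omega
  have hz2 : (fun i => z (3 * i + 2)) = fun i => decide (i = l) := by
    funext i
    simp only [z]
    rw [if_neg (by omega), if_neg (by omega)]
    congr 2; omega
  have hh : ∀ c n : ℕ, hit (fun i => decide (i = c)) n = true ↔ c ≤ n := by
    intro c n
    rw [hit_iff]
    simp
  have h : ∀ n < m, ind z n = if n ∈ Finset.Ico j l then 1 else 0 := by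
    intro n _
    rw [ind, hz1, hz2]
    refine if_congr ?_ rfl rfl
    rw [Bool.and_eq_true, hh, Bool.not_eq_true', ← Bool.not_eq_true, hh, Finset.mem_Ico, not_le]
  have := sum_EV_apply v a m z j l hl h
  rw [hz0] at this
  rw [← this]
  exact ContinuousMap.norm_coe_le_norm _ _

theorem EV_upper (v : ℕ → CantorC) (a : ℕ → ℝ) (m : ℕ) (C : ℝ)
    (hC : ∀ j l, j ≤ l → l ≤ m → ‖∑ n ∈ Finset.Ico j l, a n • v n‖ ≤ C) :
    ‖∑ n ∈ Finset.range m, a n • EV n (v n)‖ ≤ C := by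
  have hC0 : 0 ≤ C := (norm_nonneg _).trans (hC 0 0 le_rfl (Nat.zero_le _))
  refine (ContinuousMap.norm_le _ hC0).2 fun z => ?_
  obtain ⟨j, hj, hj'⟩ := hit_threshold (fun i => z (3 * i + 1)) m
  obtain ⟨l, hl, hl'⟩ := hit_threshold (fun i => z (3 * i + 2)) m
  have h : ∀ n < m, ind z n = if n ∈ Finset.Ico j (max j l) then 1 else 0 := by
    intro n hn
    rw [ind]
    refine if_congr ?_ rfl rfl
    rw [Bool.and_eq_true, hj' n hn, Bool.not_eq_true', ← Bool.not_eq_true, hl' n hn,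
      Finset.mem_Ico]
    omega
  rw [sum_EV_apply v a m z j (max j l) (max_le hj hl) h]
  exact (ContinuousMap.norm_coe_le_norm _ _).trans (hC _ _ (le_max_left _ _) (max_le hj hl))

theorem EV_norm (n : ℕ) (f : CantorC) : ‖EV n f‖ = ‖f‖ := by
  have key : ∑ i ∈ Finset.range (n + 1), (if i = n then (1 : ℝ) else 0) • EV i f = EV n f := by
    simp
  apply le_antisymm
  · refine (ContinuousMap.norm_le _ (norm_nonneg _)).2 fun z => ?_
    rw [EV_apply, norm_mul]
    have h1 : ‖ind z n‖ ≤ 1 := by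
      rw [ind]; split_ifs <;> simp
    calc _ ≤ 1 * ‖f‖ := mul_le_mul h1 (ContinuousMap.norm_coe_le_norm _ _) (norm_nonneg _) zero_le_one
      _ = _ := one_mul _
  · have := EV_lower (fun _ => f) (fun i => if i = n then (1 : ℝ) else 0) n (n + 1) (n + 1) le_rfl
    rw [key] at this
    simpa using this

theorem EV_bimonotone (v : ℕ → CantorC) : IsBimonotoneSeq fun n => EV n (v n) := by
  intro a j k m hjk hkm
  have h1 : ∑ n ∈ Finset.Ico j k, a n • EV n (v n) =
      ∑ n ∈ Finset.range k, (if j ≤ n then a n else 0) • EV n (v n) := by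
    have hsub : Finset.Ico j k ⊆ Finset.range k := by
      intro i hi
      simp only [Finset.mem_Ico, Finset.mem_range] at *
      omega
    rw [← Finset.sum_subset hsub]
    · refine Finset.sum_congr rfl fun i hi => ?_
      rw [if_pos (Finset.mem_Ico.1 hi).1]
    · intro i hi hni
      simp only [Finset.mem_Ico, Finset.mem_range] at *
      rw [if_neg (by omega), zero_smul]
  simp only [h1]
  refine EV_upper v _ k _ fun i l _ hlk => ?_
  have h2 : ∑ n ∈ Finset.Ico i l, (if j ≤ n then a n else 0) • v n =
      ∑ n ∈ Finset.Ico (max i j) l, a n • v n := by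
    have hsub : Finset.Ico (max i j) l ⊆ Finset.Ico i l := by
      intro i hi
      simp only [Finset.mem_Ico] at *
      omega
    rw [← Finset.sum_subset hsub]
    · refine Finset.sum_congr rfl fun i hi => ?_
      rw [if_pos ((le_max_right _ _).trans (Finset.mem_Ico.1 hi).1)]
    · intro i hi hni
      simp only [Finset.mem_Ico] at *
      rw [if_neg (by omega), zero_smul]
  rw [h2]
  exact EV_lower v a _ l m (hlk.trans hkm)

theorem EV_dom_lower (v : ℕ → CantorC) : DomBy v (fun n => EV n (v n)) 1 := by
  intro a n
  rw [one_mul]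
  have := EV_lower v a 0 n n le_rfl
  rwa [← Finset.range_eq_Ico] at this

theorem EV_dom_upper (v : ℕ → CantorC) {K : ℝ} (h : BasisConst v K) :
    DomBy (fun n => EV n (v n)) v (2 * K) := by
  intro a n
  refine EV_upper v a n _ fun j l hjl hln => ?_
  rw [Finset.sum_Ico_eq_sub _ hjl]
  refine (norm_sub_le _ _).trans ?_
  have := h a l n hln
  have := h a j n (hjl.trans hln)
  linarith

/-- `u` is equivalent to a basis `y` of `Y`. -/
def Good (Y : Submodule ℝ CantorC) (u y : ℕ → CantorC) (M : ℝ) : Prop :=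
  (∀ i, y i ∈ Y) ∧ (Y : Set CantorC) ⊆ closure (Submodule.span ℝ (Set.range y)) ∧
    DomBy u y M ∧ DomBy y u M ∧ BasisConst u M

theorem isClosed_dom {Z : Type*} [TopologicalSpace Z] (u v : Z → ℕ → CantorC)
    (hu : Continuous u) (hv : Continuous v) (M : ℝ) : IsClosed {p | DomBy (u p) (v p) M} := by
  have : {p | DomBy (u p) (v p) M} = ⋂ (a : ℕ → ℝ), ⋂ n : ℕ,
      {p | ‖∑ i ∈ Finset.range n, a i • u p i‖ ≤ M * ‖∑ i ∈ Finset.range n, a i • v p i‖} := by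
    ext p; simp [DomBy]
  rw [this]
  exact isClosed_iInter fun a => isClosed_iInter fun n =>
    isClosed_le (by fun_prop) (by fun_prop)

theorem isClosed_basisConst {Z : Type*} [TopologicalSpace Z] (u : Z → ℕ → CantorC)
    (hu : Continuous u) (M : ℝ) : IsClosed {p | BasisConst (u p) M} := by
  have : {p | BasisConst (u p) M} = ⋂ (a : ℕ → ℝ), ⋂ k : ℕ, ⋂ m : ℕ, ⋂ _ : k ≤ m,
      {p | ‖∑ i ∈ Finset.range k, a i • u p i‖ ≤ M * ‖∑ i ∈ Finset.range m, a i • u p i‖} := by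
    ext p; simp [BasisConst]
  rw [this]
  exact isClosed_iInter fun a => isClosed_iInter fun k => isClosed_iInter fun m =>
    isClosed_iInter fun _ => isClosed_le (by fun_prop) (by fun_prop)

theorem measurableSet_hits (f : (ℕ → ℕ) → SB) (hf : Measurable f) (U : Set CantorC)
    (hU : IsOpen U) : MeasurableSet {α | (((f α).1 : Set CantorC) ∩ U).Nonempty} :=
  hf (MeasurableSpace.measurableSet_generateFrom ⟨U, hU, rfl⟩)

theorem analytic_B (f : (ℕ → ℕ) → SB) (hf : Measurable f) (d : ℕ → CantorC) :
    AnalyticSet {k : ℕ → ℕ | ∃ (α : ℕ → ℕ) (y : ℕ → CantorC) (M : ℕ),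
      Good (f α).1 (fun n => d (k n)) y M} := by
  let _ : MeasurableSpace CantorC := borel _
  have : BorelSpace CantorC := ⟨rfl⟩
  let b := TopologicalSpace.countableBasis CantorC
  have hb : TopologicalSpace.IsTopologicalBasis b := TopologicalSpace.isBasis_countableBasis _
  have hbc : b.Countable := TopologicalSpace.countable_countableBasis _
  let P : Set ((ℕ → ℕ) × (ℕ → ℕ) × (ℕ → CantorC)) :=
    ⋃ M : ℕ, {p | Good (f p.2.1).1 (fun n => d (p.1 n)) p.2.2 M}
  have hP : MeasurableSet P := by
    refine MeasurableSet.iUnion fun M => ?_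
    have hu : Continuous fun p : (ℕ → ℕ) × (ℕ → ℕ) × (ℕ → CantorC) => fun n => d (p.1 n) := by
      refine continuous_pi fun n => ?_
      exact (continuous_of_discreteTopology (f := d)).comp
        ((continuous_apply n).comp continuous_fst)
    have hv : Continuous fun p : (ℕ → ℕ) × (ℕ → ℕ) × (ℕ → CantorC) => p.2.2 := by fun_prop
    have hhit : ∀ U ∈ b, MeasurableSet {p : (ℕ → ℕ) × (ℕ → ℕ) × (ℕ → CantorC) |
        (((f p.2.1).1 : Set CantorC) ∩ U).Nonempty} := fun U hU =>
      (measurable_fst.comp measurable_snd) (measurableSet_hits f hf U (hb.isOpen hU))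
    have h1 : MeasurableSet {p : (ℕ → ℕ) × (ℕ → ℕ) × (ℕ → CantorC) |
        ∀ i, p.2.2 i ∈ (f p.2.1).1} := by
      have : {p : (ℕ → ℕ) × (ℕ → ℕ) × (ℕ → CantorC) | ∀ i, p.2.2 i ∈ (f p.2.1).1} =
          ⋂ i : ℕ, ⋂ U ∈ b, ({p | p.2.2 i ∈ U}ᶜ ∪
            {p | (((f p.2.1).1 : Set CantorC) ∩ U).Nonempty}) := by
        ext p
        simp only [Set.mem_ofPred_eq, Set.mem_iInter, Set.mem_union, Set.mem_compl_iff,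
          ← imp_iff_not_or]
        refine forall_congr' fun i => ?_
        have h := (hb.mem_closure_iff (s := ((f p.2.1).1 : Set CantorC)) (a := p.2.2 i))
        rw [(f p.2.1).2.closure_eq] at h
        simp only [Set.inter_comm] at h ⊢
        exact h
      rw [this]
      refine MeasurableSet.iInter fun i => MeasurableSet.biInter hbc fun U hU => ?_
      refine (IsOpen.measurableSet ?_).compl.union (hhit U hU)
      exact (hb.isOpen hU).preimage (by fun_prop)
    have h2 : MeasurableSet {p : (ℕ → ℕ) × (ℕ → ℕ) × (ℕ → CantorC) |
        ((f p.2.1).1 : Set CantorC) ⊆ closure (Submodule.span ℝ (Set.range p.2.2))} := by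
      have : {p : (ℕ → ℕ) × (ℕ → ℕ) × (ℕ → CantorC) |
          ((f p.2.1).1 : Set CantorC) ⊆ closure (Submodule.span ℝ (Set.range p.2.2))} =
          ⋂ U ∈ b, ({p | (((f p.2.1).1 : Set CantorC) ∩ U).Nonempty}ᶜ ∪
            ⋃ n : ℕ, ⋃ a : ℕ → ℝ, {p | ∑ i ∈ Finset.range n, a i • p.2.2 i ∈ U}) := by
        ext p
        simp only [Set.mem_ofPred_eq, Set.mem_iInter, Set.mem_union, Set.mem_compl_iff,
          ← imp_iff_not_or, Set.mem_iUnion]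
        constructor
        · rintro h U hU ⟨z, hz, hzU⟩
          obtain ⟨w, hwU, hw⟩ := hb.mem_closure_iff.1 (h hz) U hU hzU
          obtain ⟨n, a, rfl⟩ := mem_span_range_nat.1 hw
          exact ⟨n, a, hwU⟩
        · intro h z hz
          refine hb.mem_closure_iff.2 fun U hU hzU => ?_
          obtain ⟨n, a, hw⟩ := h U hU ⟨z, hz, hzU⟩
          exact ⟨_, hw, mem_span_range_nat.2 ⟨n, a, rfl⟩⟩
      rw [this]
      refine MeasurableSet.biInter hbc fun U hU => (hhit U hU).compl.union (IsOpen.measurableSet ?_)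
      exact isOpen_iUnion fun n => isOpen_iUnion fun a =>
        (hb.isOpen hU).preimage (by fun_prop)
    exact h1.inter (h2.inter ((isClosed_dom _ _ hu hv M).measurableSet.inter
      ((isClosed_dom _ _ hv hu M).measurableSet.inter (isClosed_basisConst _ hu M).measurableSet)))
  have : PolishSpace CantorC := inferInstance
  have : SecondCountableTopology CantorC := inferInstance
  have : BorelSpace (ℕ → CantorC) := Pi.borelSpace
  have : SecondCountableTopology (ℕ → CantorC) := inferInstance
  have : BorelSpace ((ℕ → ℕ) × (ℕ → CantorC)) := Prod.borelSpace
  have : BorelSpace ((ℕ → ℕ) × (ℕ → ℕ) × (ℕ → CantorC)) := Prod.borelSpace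
  have hA := hP.analyticSet.image_of_continuous (continuous_fst)
  convert hA using 1
  ext k
  constructor
  · rintro ⟨α, y, M, h⟩
    exact ⟨(k, α, y), Set.mem_iUnion.2 ⟨M, h⟩, rfl⟩
  · rintro ⟨⟨k', α, y⟩, h, rfl⟩
    obtain ⟨M, h⟩ := Set.mem_iUnion.1 h
    exact ⟨α, y, M, h⟩

theorem Submodule.norm_coe_aux {W : Submodule ℝ CantorC} (z : W) : ‖z‖ = ‖(z : CantorC)‖ := rfl

theorem exists_good (Y : Submodule ℝ CantorC) (hYc : IsClosed (Y : Set CantorC))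
    (hY : HasSchauderBasis Y) (d : ℕ → CantorC)
    (hd : ∀ z : CantorC, ‖z‖ = 1 → ∀ ε > 0, ∃ k, ‖z - d k‖ ≤ ε) :
    ∃ (k : ℕ → ℕ) (y : ℕ → CantorC) (M : ℕ), Good Y (fun n => d (k n)) y M := by
  obtain ⟨x, hx⟩ := hY
  have : CompleteSpace Y := hYc.completeSpace_coe
  obtain ⟨K, hK, hKx⟩ := schauder_const hx
  have hne : ∀ n, x n ≠ 0 := by
    intro n hn
    have h1 : (fun _ : ℕ => (0 : ℝ)) = fun i => if i = n then 1 else 0 := by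
      refine (hx 0).unique (by simp) ?_
      have : ∀ m, ∑ i ∈ Finset.range m, (if i = n then (1 : ℝ) else 0) • x i = 0 := by
        intro m
        refine Finset.sum_eq_zero fun i _ => ?_
        by_cases h : i = n
        · rw [h, hn, smul_zero]
        · rw [if_neg h, zero_smul]
      simp only [this]
      exact tendsto_const_nhds
    have := congrFun h1 n
    simp at this
  have hne' : ∀ n, ‖(x n : CantorC)‖ ≠ 0 := fun n =>
    norm_ne_zero_iff.2 fun h => hne n (Subtype.ext h)
  let y : ℕ → CantorC := fun n => ‖(x n : CantorC)‖⁻¹ • (x n : CantorC)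
  have hy1 : ∀ n, ‖y n‖ = 1 := by
    intro n
    change ‖‖(x n : CantorC)‖⁻¹ • (x n : CantorC)‖ = 1
    rw [norm_smul, norm_inv, norm_norm]
    exact inv_mul_cancel₀ (hne' n)
  have hyK : BasisConst y K := by
    intro a k m hkm
    have := hKx (fun n => a n * ‖(x n : CantorC)‖⁻¹) k m hkm
    have e : ∀ m, ‖∑ n ∈ Finset.range m, (a n * ‖(x n : CantorC)‖⁻¹) • x n‖ =
        ‖∑ n ∈ Finset.range m, a n • y n‖ := by
      intro m
      rw [Submodule.norm_coe_aux]
      congr 1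
      push_cast
      simp only [y, smul_smul]
    exact le_of_eq_of_le (e k).symm (this.trans_eq (congrArg _ (e m)))
  choose k hk using fun n : ℕ => hd (y n) (hy1 n) ((1 / 2) ^ n / (8 * K)) (by positivity)
  obtain ⟨h1, h2⟩ := perturb hK hyK hy1 hk
  obtain ⟨M, hM⟩ := exists_nat_ge (max 2 (2 * K * 2))
  have hM1 := (le_max_left _ _).trans hM
  have hM2 := (le_max_right _ _).trans hM
  refine ⟨k, y, M, fun i => Y.smul_mem _ (x i).2, ?_, h2.mono hM1, h1.mono hM1, ?_⟩
  · intro z hz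
    obtain ⟨a, ha, -⟩ := hx ⟨z, hz⟩
    refine mem_closure_of_tendsto ((continuous_subtype_val.tendsto _).comp ha)
      (Eventually.of_forall fun m => ?_)
    refine mem_span_range_nat.2 ⟨m, fun n => a n * ‖(x n : CantorC)‖, ?_⟩
    simp only [Function.comp, y]
    push_cast
    refine Finset.sum_congr rfl fun i _ => ?_
    rw [smul_smul, mul_assoc, mul_inv_cancel₀ (hne' i), mul_one]
  · intro a i m him
    refine (const_of_dom (by norm_num) hK.le h2 h1 hyK a i m him).trans ?_
    exact mul_le_mul_of_nonneg_right hM2 (norm_nonneg _)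

theorem exists_dense_sphere : ∃ d : ℕ → CantorC, (∀ n, ‖d n‖ = 1) ∧
    ∀ z : CantorC, ‖z‖ = 1 → ∀ ε > 0, ∃ k, ‖z - d k‖ ≤ ε := by
  have : Nonempty (Metric.sphere (0 : CantorC) 1) :=
    (NormedSpace.sphere_nonempty.2 zero_le_one).to_subtype
  refine ⟨fun n => (TopologicalSpace.denseSeq (Metric.sphere (0 : CantorC) 1) n).1, fun n => ?_,
    fun z hz ε hε => ?_⟩
  · simp
  · have hz' : z ∈ Metric.sphere (0 : CantorC) 1 := by simpa using hz
    obtain ⟨k, hk⟩ := (TopologicalSpace.denseRange_denseSeq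
      (Metric.sphere (0 : CantorC) 1)).exists_dist_lt ⟨z, hz'⟩ hε
    refine ⟨k, ?_⟩
    rw [← dist_eq_norm]
    exact hk.le

theorem good_span {Y : Submodule ℝ CantorC} (hY : IsClosed (Y : Set CantorC)) {u y : ℕ → CantorC} {M : ℝ} (h : Good Y u y M) :
    (Submodule.span ℝ (Set.range y)).topologicalClosure = Y := by
  apply le_antisymm
  · refine Submodule.topologicalClosure_minimal _ ?_ hY
    rw [Submodule.span_le]
    rintro _ ⟨i, rfl⟩
    exact h.1 i
  · exact h.2.1

theorem sub_sum_norm {W : Submodule ℝ CantorC} {u' : ℕ → W} {u : ℕ → CantorC}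
    (h : ∀ n, (u' n : CantorC) = u n) (a : ℕ → ℝ) (s : Finset ℕ) :
    ‖∑ i ∈ s, a i • u' i‖ = ‖∑ i ∈ s, a i • u i‖ := by
  rw [Submodule.norm_coe_aux]
  push_cast
  simp only [h]

theorem seg_succ_props {Λ : Type*} (σ : ℕ → Λ) (n : ℕ) (c : Λ) :
    (seg σ (n + 1)).length = n + 1 ∧ (seg σ (n + 1)).getD n c = σ n := by
  have h : (seg σ (n + 1)).length = n + 1 := by rw [seg, List.length_ofFn]
  refine ⟨h, ?_⟩
  rw [List.getD_eq_getElem _ _ (by omega)]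
  simp only [seg, List.getElem_ofFn]

end construction

theorem schauder_tree_basis_of_analytic (A : Set SB) (hA : IsAnalyticIn A)
    (hbasis : ∀ Y ∈ A, HasSchauderBasis ↥Y.1) :
    ∃ (X : SB) (T : Set (List (ℕ × ℕ))) (x : List (ℕ × ℕ) → ↥X.1),
      IsTree T ∧ IsPruned T ∧
      (∀ t ∈ T, t ≠ ([] : List (ℕ × ℕ)) → ‖x t‖ = 1) ∧
      (Submodule.span ℝ (x '' {t | t ∈ T ∧ t ≠ []})).topologicalClosure =
        (⊤ : Submodule ℝ ↥X.1) ∧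
      (∀ σ : ℕ → ℕ × ℕ, IsBranch T σ →
        IsSchauderBasicSeq (fun n => x (seg σ (n + 1))) ∧
        IsBimonotoneSeq (fun n => x (seg σ (n + 1)))) ∧
      (∀ Y ∈ A, ∃ σ : ℕ → ℕ × ℕ, IsBranch T σ ∧
        IsomorphicTo ↥Y.1 ↥(branchSubspace x σ)) ∧
      (∀ σ : ℕ → ℕ × ℕ, IsBranch T σ → ∃ Y ∈ A,
        IsomorphicTo ↥(branchSubspace x σ) ↥Y.1) := by
  classical
  obtain ⟨f, hf, rfl⟩ := hA
  obtain ⟨d, hd1, hd⟩ := exists_dense_sphere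
  have hB := analytic_B f hf d
  have hex : ∀ α, ∃ (k : ℕ → ℕ) (y : ℕ → CantorC) (M : ℕ),
      Good (f α).1 (fun n => d (k n)) y M :=
    fun α => exists_good (f α).1 (f α).2 (hbasis _ ⟨α, rfl⟩) d hd
  rw [AnalyticSet] at hB
  obtain ⟨g, hg, hgr⟩ := hB.resolve_left (by
    obtain ⟨k, y, M, h⟩ := hex (fun _ => 0)
    exact Set.Nonempty.ne_empty ⟨k, _, y, M, h⟩)
  let br : (ℕ → ℕ) → ℕ → ℕ × ℕ := fun β i => (g β i, β i)
  let T : Set (List (ℕ × ℕ)) := {t | ∃ (β : ℕ → ℕ) (n : ℕ), t = seg (br β) n}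
  have hbr : ∀ β, IsBranch T (br β) := fun β n => ⟨β, n, rfl⟩
  have hbr' : ∀ σ, IsBranch T σ → ∀ n, (σ n).1 = g (fun i => (σ i).2) n := by
    intro σ hσ n
    choose β m hβ using hσ
    have hm : ∀ N, m N = N := by
      intro N
      have := congrArg List.length (hβ N)
      simpa [seg] using this.symm
    have hag : ∀ N i, i < N → σ i = br (β N) i := by
      intro N i hi
      have h1 := hβ N
      rw [hm N] at h1
      have h2 := congrFun (List.ofFn_injective h1) ⟨i, hi⟩
      exact h2
    have hlim : Tendsto β atTop (𝓝 (fun i => (σ i).2)) := by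
      rw [tendsto_pi_nhds]
      intro i
      refine tendsto_const_nhds.congr' ?_
      filter_upwards [eventually_gt_atTop i] with N hN
      rw [hag N i hN]
    have h3 := ((continuous_apply n).tendsto _).comp ((hg.tendsto _).comp hlim)
    have h4 : Tendsto (fun N => g (β N) n) atTop (𝓝 (σ n).1) := by
      refine tendsto_const_nhds.congr' ?_
      filter_upwards [eventually_gt_atTop n] with N hN
      rw [hag N n hN]
    exact tendsto_nhds_unique h4 h3
  let V : List (ℕ × ℕ) → CantorC := fun t => EV (t.length - 1) (d (t.getD (t.length - 1) (0, 0)).1)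
  have hVn : ∀ t, ‖V t‖ = 1 := fun t => by simp only [V, EV_norm, hd1]
  have hVs : ∀ σ n, V (seg σ (n + 1)) = EV n (d (σ n).1) := by
    intro σ n
    obtain ⟨h1, h2⟩ := seg_succ_props σ n ((0, 0) : ℕ × ℕ)
    simp only [V, h1, Nat.add_sub_cancel, h2]
  let Xs : Submodule ℝ CantorC :=
    (Submodule.span ℝ (V '' {t | t ∈ T ∧ t ≠ []})).topologicalClosure
  have hXcl : IsClosed (Xs : Set CantorC) := Submodule.isClosed_topologicalClosure _
  have hXc : CompleteSpace Xs := hXcl.completeSpace_coe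
  have hVX : ∀ t, t ∈ T ∧ t ≠ [] → V t ∈ Xs := fun t ht =>
    Submodule.le_topologicalClosure _ (Submodule.subset_span ⟨t, ht, rfl⟩)
  let x : List (ℕ × ℕ) → Xs := fun t => if h : t ∈ T ∧ t ≠ [] then ⟨V t, hVX t h⟩ else 0
  have hxV : ∀ t, t ∈ T ∧ t ≠ [] → (x t : CantorC) = V t := fun t ht => by
    simp only [x, dif_pos ht]
  have hxb : ∀ σ, IsBranch T σ → ∀ n, (x (seg σ (n + 1)) : CantorC) = EV n (d (σ n).1) := by
    intro σ hσ n
    have hne : seg σ (n + 1) ≠ [] := by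
      intro h
      have := congrArg List.length h
      simp [seg] at this
    rw [hxV (seg σ (n + 1)) ⟨hσ (n + 1), hne⟩, hVs]
  have hbim : ∀ σ, IsBranch T σ → IsBimonotoneSeq (fun n => x (seg σ (n + 1))) := by
    intro σ hσ a j k m hjk hkm
    rw [sub_sum_norm (hxb σ hσ), sub_sum_norm (hxb σ hσ)]
    exact EV_bimonotone (fun n => d (σ n).1) a j k m hjk hkm
  have hx1 : ∀ t ∈ T, t ≠ ([] : List (ℕ × ℕ)) → ‖x t‖ = 1 := by
    intro t ht hne
    rw [Submodule.norm_coe_aux, hxV t ⟨ht, hne⟩, hVn]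
  have hiso : ∀ σ, IsBranch T σ → ∀ (Y : SB) (y : ℕ → CantorC) (M : ℕ),
      Good Y.1 (fun n => d (σ n).1) y M →
      Nonempty (↥(branchSubspace x σ) ≃L[ℝ] ↥Y.1) := by
    intro σ hσ Y y M h
    have hs := good_span Y.2 h
    obtain ⟨-, -, h1, h2, h3⟩ := h
    have hM0 : (0 : ℝ) ≤ M := Nat.cast_nonneg M
    have e1 : DomBy (fun n => x (seg σ (n + 1))) y (2 * M * M) := by
      intro a n
      rw [sub_sum_norm (hxb σ hσ)]
      exact (EV_dom_upper _ h3).trans (by positivity) h1 a n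
    have e2 : DomBy y (fun n => x (seg σ (n + 1))) (M * 1) := by
      intro a n
      rw [sub_sum_norm (hxb σ hσ)]
      exact h2.trans hM0 (EV_dom_lower _) a n
    obtain ⟨e⟩ := iso_of_equiv (M := 2 * M * M + M * 1 + 1) (by positivity)
      (e1.mono (by nlinarith)) (e2.mono (by nlinarith))
    exact ⟨e.trans (ContinuousLinearEquiv.ofEq _ _ hs)⟩
  refine ⟨⟨Xs, hXcl⟩, T, x, ?_, ?_, hx1, ?_, ?_, ?_, ?_⟩
  · rintro s t hst ⟨β, n, rfl⟩
    refine ⟨β, s.length, ?_⟩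
    have hlen : s.length ≤ n := by simpa [seg] using hst.length_le
    refine List.ext_getElem (by simp [seg]) fun i h1 h2 => ?_
    rw [hst.getElem h1]
    simp [seg]
  · rintro t ⟨β, n, rfl⟩
    refine ⟨br β n, β, n + 1, ?_⟩
    simp only [seg]
    rw [List.ofFn_succ_last]
    rfl
  · refine span_subtype_dense Xs _ ?_
    rw [Set.image_image]
    have : (fun t => (x t : CantorC)) '' {t | t ∈ T ∧ t ≠ []} = V '' {t | t ∈ T ∧ t ≠ []} :=
      Set.image_congr fun t ht => hxV t ht
    rw [this]
  · intro σ hσ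
    refine ⟨basic_of_const (K := 1) one_pos ?_ ?_, hbim σ hσ⟩
    · intro a k m hkm
      have := hbim σ hσ a 0 k m (Nat.zero_le _) hkm
      rwa [← Finset.range_eq_Ico, ← one_mul ‖∑ n ∈ Finset.range m, _‖] at this
    · intro n h0
      have h1 := hxb σ hσ n
      rw [h0] at h1
      have h2 := congrArg norm h1
      rw [EV_norm, hd1] at h2
      simp at h2
  · rintro _ ⟨α, rfl⟩
    obtain ⟨k, y, M, h⟩ := hex α
    have hk : k ∈ Set.range g := by rw [hgr]; exact ⟨α, y, M, h⟩
    obtain ⟨β, rfl⟩ := hk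
    obtain ⟨e⟩ := hiso (br β) (hbr β) (f α) y M h
    exact ⟨br β, hbr β, ⟨e.symm⟩⟩
  · intro σ hσ
    have hk : g (fun i => (σ i).2) ∈ Set.range g := ⟨_, rfl⟩
    rw [hgr] at hk
    obtain ⟨α, y, M, h⟩ := hk
    refine ⟨f α, ⟨α, rfl⟩, hiso σ hσ (f α) y M ?_⟩
    simpa only [hbr' σ hσ] using h
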